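/- arXiv:1506.06493 — 2 statements merged into one kernel-verified Lean document; each statement's English description precedes it below -/
import Mathlib

section
/- Let v, v_* ∈ ℝ³ with v × v_* ≠ 0, and set k = (v−v_*)/|v−v_*|, i = (v × v_*)/|v × v_*|, h = i × k. For θ ∈ [0,π) and φ ∈ [−π,π), let σ = k cos θ + sin θ (h cos φ + i sin φ) ∈ 𝕊², and define v' = (v+v_*)/2 + (|v−v_*|/2)σ and v'_* = (v+v_*)/2 − (|v−v_*|/2)σ. Then |v'|² = |v|² cos²(θ/2) + |v_*|² sin²(θ/2) + |v × v_*| sin θ cos φ and |v'_*|² = |v_*|² cos²(θ/2) + |v|² sin²(θ/2) − |v × v_*| sin θ cos φ. -/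
open scoped Real

noncomputable section

/-- `ℝ³` as a Euclidean space. -/
abbrev E3 : Type := EuclideanSpace ℝ (Fin 3)

/-- The cross product on `ℝ³` (Euclidean space), via the coordinate cross product. -/
def cross3 (a c : E3) : E3 :=
  (WithLp.equiv 2 (Fin 3 → ℝ)).symm
    (crossProduct ((WithLp.equiv 2 (Fin 3 → ℝ)) a) ((WithLp.equiv 2 (Fin 3 → ℝ)) c))

theorem inner_eq_sum_three (a b : E3) :
    inner ℝ a b = a 0 * b 0 + a 1 * b 1 + a 2 * b 2 := by
  simp [PiLp.inner_apply, Fin.sum_univ_three, mul_comm]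

theorem cross3_apply_zero (a b : E3) : cross3 a b 0 = a 1 * b 2 - a 2 * b 1 := by
  simp [cross3, cross_apply]

theorem cross3_apply_one (a b : E3) : cross3 a b 1 = a 2 * b 0 - a 0 * b 2 := by
  simp [cross3, cross_apply]

theorem cross3_apply_two (a b : E3) : cross3 a b 2 = a 0 * b 1 - a 1 * b 0 := by
  simp [cross3, cross_apply]

theorem cross3_self (a : E3) : cross3 a a = 0 := by
  simp [cross3]

theorem inner_cross3_left (a b : E3) : inner ℝ a (cross3 a b) = 0 := by
  rw [inner_eq_sum_three, cross3_apply_zero, cross3_apply_one, cross3_apply_two]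
  ring

theorem inner_cross3_right (a b : E3) : inner ℝ b (cross3 a b) = 0 := by
  rw [inner_eq_sum_three, cross3_apply_zero, cross3_apply_one, cross3_apply_two]
  ring

theorem inner_cross3_self (a b : E3) :
    inner ℝ (cross3 a b) (cross3 a b) =
      inner ℝ a a * inner ℝ b b - inner ℝ a b * inner ℝ a b := by
  simp only [inner_eq_sum_three, cross3_apply_zero, cross3_apply_one, cross3_apply_two]
  ring

/-- A scaled triple product: pairing `v + w` with `(s • v × w) × (t • (v - w))`. -/
theorem inner_add_cross3_smul_cross3_smul_sub (v w : E3) (s t : ℝ) :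
    inner ℝ (v + w) (cross3 (s • cross3 v w) (t • (v - w))) =
      2 * s * t * inner ℝ (cross3 v w) (cross3 v w) := by
  simp only [inner_eq_sum_three, cross3_apply_zero, cross3_apply_one, cross3_apply_two,
    PiLp.add_apply, PiLp.sub_apply, PiLp.smul_apply, smul_eq_mul]
  ring

/-- Spherical coordinates with respect to an orthonormal frame give a unit vector. -/
theorem inner_self_spherical {k h i : E3} (hk : inner ℝ k k = 1) (hh : inner ℝ h h = 1)
    (hi : inner ℝ i i = 1) (hkh : inner ℝ k h = 0) (hki : inner ℝ k i = 0)
    (hih : inner ℝ i h = 0) (θ φ : ℝ) :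
    inner ℝ (Real.cos θ • k + Real.sin θ • (Real.cos φ • h + Real.sin φ • i))
      (Real.cos θ • k + Real.sin θ • (Real.cos φ • h + Real.sin φ • i)) = 1 := by
  have hhk := real_inner_comm h k
  have hik := real_inner_comm i k
  have hhi := real_inner_comm i h
  simp only [inner_add_left, inner_add_right, real_inner_smul_left, real_inner_smul_right,
    hk, hh, hi, hkh, hki, hih, show inner ℝ h k = 0 by linarith,
    show inner ℝ i k = 0 by linarith, show inner ℝ h i = 0 by linarith]
  linear_combination Real.sin θ ^ 2 * Real.sin_sq_add_cos_sq φ + Real.sin_sq_add_cos_sq θ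

/-- the explicit collision geometry formulas. With
`k = (v−v_*)/|v−v_*|`, `i = (v×v_*)/|v×v_*|`, `h = i×k`,
`σ = k cos θ + sin θ (h cos φ + i sin φ)`,
`v' = (v+v_*)/2 + (|v−v_*|/2)σ` and `v'_* = (v+v_*)/2 − (|v−v_*|/2)σ`, one has
`|v'|² = |v|² cos²(θ/2) + |v_*|² sin²(θ/2) + |v×v_*| sin θ cos φ` and
`|v'_*|² = |v_*|² cos²(θ/2) + |v|² sin²(θ/2) − |v×v_*| sin θ cos φ`. -/
theorem stmt17 (v vs : E3) (hcross : cross3 v vs ≠ 0)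
    (θ φ : ℝ) (hθ0 : 0 ≤ θ) (hθπ : θ < π) (hφ0 : -π ≤ φ) (hφπ : φ < π) :
    let k : E3 := ‖v - vs‖⁻¹ • (v - vs)
    let i : E3 := ‖cross3 v vs‖⁻¹ • cross3 v vs
    let h : E3 := cross3 i k
    let σ : E3 := Real.cos θ • k + Real.sin θ • (Real.cos φ • h + Real.sin φ • i)
    let v' : E3 := (2⁻¹ : ℝ) • (v + vs) + (‖v - vs‖ / 2) • σ
    let v's : E3 := (2⁻¹ : ℝ) • (v + vs) - (‖v - vs‖ / 2) • σ
    ‖v'‖ ^ 2 = ‖v‖ ^ 2 * Real.cos (θ / 2) ^ 2 + ‖vs‖ ^ 2 * Real.sin (θ / 2) ^ 2 +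
        ‖cross3 v vs‖ * Real.sin θ * Real.cos φ ∧
      ‖v's‖ ^ 2 = ‖vs‖ ^ 2 * Real.cos (θ / 2) ^ 2 + ‖v‖ ^ 2 * Real.sin (θ / 2) ^ 2 -
        ‖cross3 v vs‖ * Real.sin θ * Real.cos φ := by
  intro k i h σ v' v's
  have hn : ‖cross3 v vs‖ ≠ 0 := norm_ne_zero_iff.mpr hcross
  have ha : ‖v - vs‖ ≠ 0 := by
    rw [norm_ne_zero_iff, sub_ne_zero]
    rintro rfl
    exact hcross (cross3_self v)
  have hk : inner ℝ k k = 1 := by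
    rw [real_inner_smul_left, real_inner_smul_right, real_inner_self_eq_norm_sq]
    field_simp
  have hi : inner ℝ i i = 1 := by
    rw [real_inner_smul_left, real_inner_smul_right, real_inner_self_eq_norm_sq]
    field_simp
  have hki : inner ℝ k i = 0 := by
    simp only [k, i, real_inner_smul_left, real_inner_smul_right, inner_sub_left,
      inner_cross3_left, inner_cross3_right]
    ring
  have hik : inner ℝ i k = 0 := by rw [real_inner_comm, hki]
  have hh : inner ℝ h h = 1 := by
    simp only [h, inner_cross3_self, hi, hk, hik]
    ring
  have hσ : inner ℝ σ σ = 1 :=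
    inner_self_spherical hk hh hi (inner_cross3_right i k) hki (inner_cross3_left i k) θ φ
  have hVk : ‖v - vs‖ * inner ℝ (v + vs) k = ‖v‖ ^ 2 - ‖vs‖ ^ 2 := by
    simp only [k, real_inner_smul_right, inner_add_left, inner_sub_right,
      real_inner_self_eq_norm_sq, real_inner_comm v vs]
    field_simp
    ring
  have hVh : ‖v - vs‖ * inner ℝ (v + vs) h = 2 * ‖cross3 v vs‖ := by
    simp only [h, i, k, inner_add_cross3_smul_cross3_smul_sub, real_inner_self_eq_norm_sq]
    field_simp
  have hVi : inner ℝ (v + vs) i = 0 := by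
    simp only [i, real_inner_smul_right, inner_add_left, inner_cross3_left, inner_cross3_right]
    ring
  have hVσ : ‖v - vs‖ * inner ℝ (v + vs) σ =
      Real.cos θ * (‖v‖ ^ 2 - ‖vs‖ ^ 2) +
        2 * ‖cross3 v vs‖ * Real.sin θ * Real.cos φ := by
    simp only [σ, inner_add_right, real_inner_smul_right, hVi]
    linear_combination Real.cos θ * hVk + Real.sin θ * Real.cos φ * hVh
  have hpar := parallelogram_law_with_norm ℝ v vs
  have hσn : ‖σ‖ ^ 2 = 1 := by rw [← real_inner_self_eq_norm_sq, hσ]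
  have hcos : Real.cos (θ / 2) ^ 2 = 1 / 2 + Real.cos θ / 2 := by
    rw [Real.cos_sq, mul_div_cancel₀ θ two_ne_zero]
  have hsin : Real.sin (θ / 2) ^ 2 = 1 / 2 - Real.cos θ / 2 := by
    rw [Real.sin_sq, hcos]
    ring
  constructor
  · rw [hcos, hsin, norm_add_sq_real, real_inner_smul_left, real_inner_smul_right,
      norm_smul, norm_smul, mul_pow, mul_pow, hσn, Real.norm_eq_abs, Real.norm_eq_abs,
      sq_abs, sq_abs]
    linear_combination hVσ / 2 + hpar / 4
  · rw [hcos, hsin, norm_sub_sq_real, real_inner_smul_left, real_inner_smul_right,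
      norm_smul, norm_smul, mul_pow, mul_pow, hσn, Real.norm_eq_abs, Real.norm_eq_abs,
      sq_abs, sq_abs]
    linear_combination -hVσ / 2 + hpar / 4

end
end

section
/- Let Ψ : ℝ → ℝ be twice continuously differentiable and let Y, Z ∈ ℝ. Then ∫₀^π Ψ(Y + Z cos φ) dφ = π Ψ(Y) + Z² ∫₀^{π/2} (sin φ − φ cos φ) sin φ [Ψ''(Y + Z cos φ) + Ψ''(Y − Z cos φ)] dφ. -/
open scoped Real
open intervalIntegral

noncomputable section

/-- the integration-by-parts identity
`∫₀^π Ψ(Y + Z cos φ) dφ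
  = π Ψ(Y) + Z² ∫₀^{π/2} (sin φ − φ cos φ) sin φ [Ψ''(Y + Z cos φ) + Ψ''(Y − Z cos φ)] dφ`
for any twice continuously differentiable `Ψ : ℝ → ℝ`. -/
theorem stmt18 (Ψ : ℝ → ℝ) (hΨ : ContDiff ℝ 2 Ψ) (Y Z : ℝ) :
    (∫ φ in (0:ℝ)..π, Ψ (Y + Z * Real.cos φ)) =
      π * Ψ Y + Z ^ 2 *
        ∫ φ in (0:ℝ)..(π / 2),
          (Real.sin φ - φ * Real.cos φ) * Real.sin φ *
            (deriv (deriv Ψ) (Y + Z * Real.cos φ) + deriv (deriv Ψ) (Y - Z * Real.cos φ)) := by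
  have h₁ : Differentiable ℝ Ψ := hΨ.differentiable (by norm_num)
  have h₁' : ContDiff ℝ 1 (deriv Ψ) := ((contDiff_succ_iff_deriv (n := 1)).1 hΨ).2.2
  have h₂ : Differentiable ℝ (deriv Ψ) := h₁'.differentiable (by norm_num)
  have hc₀ : Continuous Ψ := hΨ.continuous
  have hc₂ : Continuous (deriv (deriv Ψ)) := h₁'.continuous_deriv (by norm_num)
  have hi : ∀ {f : ℝ → ℝ} (a b : ℝ), Continuous f → IntervalIntegrable f MeasureTheory.volume a b :=
    fun a b hf => hf.intervalIntegrable a b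
  have hsplit : (∫ φ in (0:ℝ)..π, Ψ (Y + Z * Real.cos φ)) =
      (∫ φ in (0:ℝ)..(π / 2), Ψ (Y + Z * Real.cos φ)) +
        ∫ φ in (0:ℝ)..(π / 2), Ψ (Y - Z * Real.cos φ) := by
    have hcont : Continuous fun φ => Ψ (Y + Z * Real.cos φ) := by fun_prop
    rw [← integral_add_adjacent_intervals (hi 0 (π / 2) hcont) (hi (π / 2) π hcont)]
    have hrefl := integral_comp_sub_left (a := 0) (b := π / 2)
      (fun φ => Ψ (Y + Z * Real.cos φ)) π
    simp only [Real.cos_pi_sub, sub_zero, sub_half, mul_neg, ← sub_eq_add_neg] at hrefl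
    rw [hrefl]
  have hder : ∀ φ : ℝ, HasDerivAt
      (fun φ => -(φ * (Ψ (Y + Z * Real.cos φ) + Ψ (Y - Z * Real.cos φ)))
        - Z * ((Real.sin φ - φ * Real.cos φ) *
          (deriv Ψ (Y + Z * Real.cos φ) - deriv Ψ (Y - Z * Real.cos φ))))
      (Z ^ 2 * ((Real.sin φ - φ * Real.cos φ) * Real.sin φ *
          (deriv (deriv Ψ) (Y + Z * Real.cos φ) + deriv (deriv Ψ) (Y - Z * Real.cos φ)))
        - (Ψ (Y + Z * Real.cos φ) + Ψ (Y - Z * Real.cos φ))) φ := by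
    intro φ
    have hp := ((Real.hasDerivAt_cos φ).const_mul Z).const_add Y
    have hm := ((Real.hasDerivAt_cos φ).const_mul Z).const_sub Y
    have hw := (Real.hasDerivAt_sin φ).sub ((hasDerivAt_id φ).mul (Real.hasDerivAt_cos φ))
    have hΨp := (h₁ (Y + Z * Real.cos φ)).hasDerivAt.comp φ hp
    have hΨm := (h₁ (Y - Z * Real.cos φ)).hasDerivAt.comp φ hm
    have hΨp' := (h₂ (Y + Z * Real.cos φ)).hasDerivAt.comp φ hp
    have hΨm' := (h₂ (Y - Z * Real.cos φ)).hasDerivAt.comp φ hm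
    refine (((hasDerivAt_id φ).mul (hΨp.add hΨm)).neg.sub
      ((hw.mul (hΨp'.sub hΨm')).const_mul Z)).congr_deriv ?_
    simp only [Pi.add_apply, Pi.sub_apply, Pi.mul_apply, Function.comp_apply, id_eq]
    ring
  have hftc := integral_eq_sub_of_hasDerivAt (a := 0) (b := π / 2) (fun φ _ => hder φ)
    (hi _ _ (by fun_prop))
  rw [integral_sub (hi _ _ (by fun_prop)) (hi _ _ (by fun_prop)),
    integral_add (hi _ _ (by fun_prop)) (hi _ _ (by fun_prop)),
    intervalIntegral.integral_const_mul] at hftc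
  simp only [Real.cos_pi_div_two, Real.sin_pi_div_two, Real.sin_zero, mul_zero, add_zero,
    sub_zero, zero_mul, sub_self, neg_zero] at hftc
  rw [hsplit]
  linarith

end
end
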